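/- arXiv:2204.07398 — 11 statements merged into one kernel-verified Lean document; each statement's English description precedes it below -/
import Mathlib

section
/- Let P be a decreasing probability distribution on ℕ. Then for every integer i ≥ 1 and every integer n ≥ 1 with P(n) > 0, one has -log₂(P(0)^i · P(n)) ≥ 1 + log₂ n + log₂(i+1). -/
/-- Three terms of the binomial expansion of `(a + (1 - a)) ^ (k + 2) = 1`. -/
theorem binomial_three_terms_le_one {a : ℝ} (h0 : 0 ≤ a) (h1 : a ≤ 1) (k : ℕ) :
    a ^ k * (a ^ 2 + (k + 2) * a * (1 - a) + (k + 2) * (k + 1) / 2 * (1 - a) ^ 2) ≤ 1 := by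
  induction k with
  | zero => norm_num; nlinarith
  | succ k ih =>
    refine le_trans ?_ ih
    have hb : 0 ≤ 1 - a := by linarith
    have h : 0 ≤ a ^ k * (((k : ℝ) + 2) * (k + 1) / 2 * (1 - a) ^ 3) := by positivity
    refine sub_nonneg.mp (h.trans_eq ?_)
    push_cast
    ring

theorem two_mul_succ_mul_pow_mul_one_sub_le_one {a : ℝ} (h0 : 0 ≤ a) (h1 : a ≤ 1)
    {i : ℕ} (hi : 1 ≤ i) : 2 * ((i : ℝ) + 1) * a ^ i * (1 - a) ≤ 1 := by
  obtain ⟨k, rfl⟩ := Nat.exists_eq_add_of_le' hi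
  refine le_trans ?_ (binomial_three_terms_le_one h0 h1 k)
  have hq : 0 ≤ (a - (k + 2) / 2 * (1 - a)) ^ 2 + (k + 2) * k / 4 * (1 - a) ^ 2 := by
    positivity
  have h := mul_nonneg (pow_nonneg h0 k) hq
  refine sub_nonneg.mp (h.trans_eq ?_)
  push_cast
  ring

/-- A decreasing nonnegative sequence with sum `1` satisfies `P 0 + n * P n ≤ 1`. -/
theorem zero_add_mul_le_one_of_antitone {P : ℕ → ℝ} (hnonneg : ∀ m, 0 ≤ P m)
    (hP : Antitone P) (hsum : HasSum P 1) (n : ℕ) : P 0 + n * P n ≤ 1 := by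
  have h := sum_le_hasSum (Finset.range (n + 1)) (fun m _ => hnonneg m) hsum
  rw [Finset.sum_range_succ'] at h
  have h' : (n : ℝ) * P n ≤ ∑ m ∈ Finset.range n, P (m + 1) := by
    simpa using Finset.card_nsmul_le_sum (Finset.range n) (fun m => P (m + 1)) (P n)
      fun m hm => hP (Finset.mem_range.mp hm)
  linarith

/-- For a decreasing probability distribution `P` on ℕ, every `i ≥ 1`
and `n ≥ 1` with `P n > 0` satisfy
`-log₂(P(0)^i · P(n)) ≥ 1 + log₂ n + log₂ (i+1)`. -/
theorem stmt_0 (P : ℕ → ℝ)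
    (hnonneg : ∀ m, 0 ≤ P m)
    (hmono : ∀ m, P (m + 1) ≤ P m)
    (hsum : HasSum P 1)
    (i n : ℕ) (hi : 1 ≤ i) (hn : 1 ≤ n) (hPn : 0 < P n) :
    1 + Real.logb 2 n + Real.logb 2 (i + 1) ≤ -Real.logb 2 (P 0 ^ i * P n) := by
  have hP : Antitone P := antitone_nat_of_succ_le hmono
  have hP0 : 0 < P 0 := hPn.trans_le (hP n.zero_le)
  have hle := zero_add_mul_le_one_of_antitone hnonneg hP hsum n
  have hn' : (0 : ℝ) < n := by exact_mod_cast hn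
  have hnP : 0 < n * P n := mul_pos hn' hPn
  have key : 2 * n * (i + 1) * (P 0 ^ i * P n) ≤ 1 :=
    calc 2 * n * (i + 1) * (P 0 ^ i * P n) = 2 * ((i : ℝ) + 1) * P 0 ^ i * (n * P n) := by ring
      _ ≤ 2 * ((i : ℝ) + 1) * P 0 ^ i * (1 - P 0) := by gcongr; linarith
      _ ≤ 1 := two_mul_succ_mul_pow_mul_one_sub_le_one hP0.le (by linarith) hi
  have hlog : Real.logb 2 (2 * n * (i + 1) * (P 0 ^ i * P n)) ≤ 0 :=
    Real.logb_nonpos one_lt_two (by positivity) key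
  rw [Real.logb_mul (by positivity) (by positivity), Real.logb_mul (by positivity) (by positivity),
    Real.logb_mul two_ne_zero hn'.ne', Real.logb_self_eq_one one_lt_two] at hlog
  linarith
end

section
/- Let a and b be two positive real numbers and let P be a decreasing probability distribution on ℕ. Then for every integer i ≥ 0 and every integer n ≥ 1 with P(n) > 0, one has 2a + b·log₂ n + b·log₂(i+1) ≤ -(2a+b)·log₂(P(0)^i · P(n)). -/
/-- Each term of the geometric sum `∑ k ≤ i, x ^ k` is at least `x ^ i` when `0 ≤ x ≤ 1`. -/
lemma succ_mul_pow_mul_one_sub_le {x : ℝ} (h0 : 0 ≤ x) (h1 : x ≤ 1) (i : ℕ) :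
    ((i : ℝ) + 1) * x ^ i * (1 - x) ≤ 1 - x ^ (i + 1) := by
  induction i with
  | zero => simp
  | succ k ih =>
    have hpow : x ^ (k + 1) ≤ 1 := pow_le_one₀ h0 h1
    have hstep := mul_le_mul_of_nonneg_left ih h0
    have hrest := mul_le_mul_of_nonneg_right hpow (sub_nonneg.2 h1)
    push_cast
    simp only [pow_succ] at *
    linarith

/-- A decreasing nonnegative sequence with sum `s` satisfies `P 0 + n * P n ≤ s`. -/
lemma Antitone.zero_add_mul_le_of_hasSum {P : ℕ → ℝ} {s : ℝ} (hanti : Antitone P)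
    (hnonneg : ∀ m, 0 ≤ P m) (hsum : HasSum P s) (n : ℕ) : P 0 + n * P n ≤ s := by
  have hpartial := sum_le_hasSum (Finset.range (n + 1)) (fun m _ => hnonneg m) hsum
  rw [Finset.sum_range_succ'] at hpartial
  have hcard : (Finset.range n).card • P n ≤ ∑ k ∈ Finset.range n, P (k + 1) :=
    Finset.card_nsmul_le_sum _ _ _ fun k hk => hanti (Finset.mem_range.1 hk)
  rw [Finset.card_range, nsmul_eq_mul] at hcard
  linarith

/-- For positive reals `a`, `b` and a decreasing probability distribution
`P` on ℕ, every `i ≥ 0` and `n ≥ 1` with `P n > 0` satisfy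
`2a + b·log₂ n + b·log₂(i+1) ≤ -(2a+b)·log₂(P(0)^i · P(n))`. -/
theorem stmt_1 (a b : ℝ) (ha : 0 < a) (hb : 0 < b) (P : ℕ → ℝ)
    (hnonneg : ∀ m, 0 ≤ P m)
    (hmono : ∀ m, P (m + 1) ≤ P m)
    (hsum : HasSum P 1)
    (i n : ℕ) (hn : 1 ≤ n) (hPn : 0 < P n) :
    2 * a + b * Real.logb 2 n + b * Real.logb 2 (i + 1)
      ≤ -((2 * a + b) * Real.logb 2 (P 0 ^ i * P n)) := by
  have hanti : Antitone P := antitone_nat_of_succ_le hmono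
  have hbound := hanti.zero_add_mul_le_of_hasSum hnonneg hsum n
  have hle : P n ≤ P 0 := hanti (Nat.zero_le n)
  have hn' : (1 : ℝ) ≤ n := by exact_mod_cast hn
  have hP0 : 0 < P 0 := hPn.trans_le hle
  have hnP : P n ≤ n * P n := le_mul_of_one_le_left hPn.le hn'
  have hP0le : P 0 ≤ 1 := by linarith
  have hi : (0 : ℝ) < i + 1 := by positivity
  have hQ : 0 < P 0 ^ i * P n := by positivity
  have hhalf : P 0 ^ i * P n ≤ 1 / 2 := by
    have := mul_le_of_le_one_left hPn.le (pow_le_one₀ hP0.le hP0le : P 0 ^ i ≤ 1)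
    linarith
  have hprod : (n : ℝ) * (i + 1) * (P 0 ^ i * P n) ≤ 1 := by
    have hgeom := succ_mul_pow_mul_one_sub_le hP0.le hP0le i
    have hpow : 0 < P 0 ^ (i + 1) := by positivity
    calc (n : ℝ) * (i + 1) * (P 0 ^ i * P n)
        = ((i : ℝ) + 1) * P 0 ^ i * (n * P n) := by ring
      _ ≤ ((i : ℝ) + 1) * P 0 ^ i * (1 - P 0) :=
          mul_le_mul_of_nonneg_left (by linarith) (by positivity)
      _ ≤ 1 := by linarith
  have hloghalf : Real.logb 2 (P 0 ^ i * P n) ≤ -1 := by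
    rw [Real.logb_le_iff_le_rpow one_lt_two hQ, Real.rpow_neg_one]
    linarith
  have hlogprod : Real.logb 2 n + Real.logb 2 (i + 1) + Real.logb 2 (P 0 ^ i * P n) ≤ 0 := by
    rw [← Real.logb_mul (by positivity) hi.ne', ← Real.logb_mul (by positivity) hQ.ne']
    exact Real.logb_nonpos one_lt_two (by positivity) hprod
  have h₁ := mul_le_mul_of_nonneg_left hloghalf ha.le
  have h₂ := mul_le_mul_of_nonneg_left hlogprod hb.le
  linarith
end

section
/- Let P be a decreasing probability distribution on ℕ with 0 < P(0) < 1 whose entropy series converges, and suppose L : ℕ⁺ → ℕ satisfies 1 ≤ L(n) ≤ a + b·log₂ n for all n ≥ 1, where a, b are positive constants. Then (1 - P(0)) · ∑_{i=0}^∞ ∑_{n=1}^∞ P(0)^i P(n) (L(i+1) + L(n)) ≤ (2a+b) · H(P). (Equivalently, the coding rate R_C of the RLE-based VV code C = (D_RLE, φ_L) satisfies R_C / H(P) ≤ 2a + b.) -/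
/-- A nonnegative antitone sequence with sum `q` satisfies `(n + 1) * Q n ≤ q`. -/
lemma succ_mul_le_of_antitone_of_hasSum {Q : ℕ → ℝ} {q : ℝ} (h0 : ∀ n, 0 ≤ Q n)
    (hanti : Antitone Q) (hQ : HasSum Q q) (n : ℕ) : ((n : ℝ) + 1) * Q n ≤ q := by
  have h1 : ∑ k ∈ Finset.range (n + 1), Q n ≤ ∑ k ∈ Finset.range (n + 1), Q k :=
    Finset.sum_le_sum fun k hk => hanti (Nat.lt_succ_iff.mp (Finset.mem_range.mp hk))
  have h2 := sum_le_hasSum (Finset.range (n + 1)) (fun k _ => h0 k) hQ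
  simp only [Finset.sum_const, Finset.card_range, nsmul_eq_mul, Nat.cast_add, Nat.cast_one] at h1
  linarith

/-- The tangent line bound for `logb 2` at `q⁻¹`. -/
lemma logb_two_le_tangent {q x : ℝ} (hq : 0 < q) (hx : 0 < x) :
    Real.logb 2 x ≤ -Real.logb 2 q + (x * q - 1) / Real.log 2 := by
  have h2 : 0 < Real.log 2 := Real.log_pos one_lt_two
  have h := Real.log_le_sub_one_of_pos (mul_pos hx hq)
  rw [Real.log_mul hx.ne' hq.ne'] at h
  unfold Real.logb
  rw [← neg_div, ← add_div]
  gcongr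
  linarith

/-- The geometric series weighted by an affine function of `(i + 1) * (1 - p) - 1`, which has
mean zero. -/
lemma hasSum_geometric_mul_affine {p : ℝ} (h0 : 0 ≤ p) (h1 : p < 1) (c d : ℝ) :
    HasSum (fun i : ℕ => p ^ i * (c + d * (((i : ℝ) + 1) * (1 - p) - 1))) (c / (1 - p)) := by
  have hq : 1 - p ≠ 0 := by linarith
  have hg := hasSum_geometric_of_lt_one h0 h1
  have hn := hasSum_coe_mul_geometric_of_norm_lt_one (r := p)
    (by rwa [Real.norm_eq_abs, abs_of_nonneg h0])
  have h := (hg.mul_left (c + d * ((1 - p) - 1))).add (hn.mul_left (d * (1 - p)))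
  have hval : (c + d * ((1 - p) - 1)) * (1 - p)⁻¹ + d * (1 - p) * (p / (1 - p) ^ 2) =
      c / (1 - p) := by
    field_simp
    ring
  rw [hval] at h
  exact (funext fun i => by ring : (fun i : ℕ => p ^ i * (c + d * (((i : ℝ) + 1) * (1 - p) - 1))) =
    fun i : ℕ => (c + d * ((1 - p) - 1)) * p ^ i + d * (1 - p) * (i * p ^ i)) ▸ h

/-- For a DPD `P` on ℕ with `0 < P 0 < 1` and convergent entropy series,
and a length function `L` with `1 ≤ L n ≤ a + b·log₂ n` for `n ≥ 1` (`a, b > 0`),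
the coding rate of the RLE-based VV code satisfies `R_C ≤ (2a+b)·H(P)`, i.e.
`(1 - P 0) · ∑_{i,n} P(0)^i P(n) (L(i+1)+L(n)) ≤ (2a+b)·H(P)`. -/
theorem stmt_2 (P : ℕ → ℝ)
    (hnonneg : ∀ m, 0 ≤ P m)
    (hmono : ∀ m, P (m + 1) ≤ P m)
    (hsum : HasSum P 1)
    (hP0 : 0 < P 0) (hP0' : P 0 < 1)
    (hent : Summable (fun n => P n * Real.logb 2 (P n)))
    (a b : ℝ) (ha : 0 < a) (hb : 0 < b)
    (L : ℕ → ℕ)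
    (hL1 : ∀ n : ℕ, 1 ≤ n → 1 ≤ L n)
    (hL2 : ∀ n : ℕ, 1 ≤ n → (L n : ℝ) ≤ a + b * Real.logb 2 n) :
    (1 - P 0) *
        ∑' i : ℕ, ∑' n : ℕ, P 0 ^ i * P (n + 1) * ((L (i + 1) : ℝ) + (L (n + 1) : ℝ))
      ≤ (2 * a + b) * (-∑' n : ℕ, P n * Real.logb 2 (P n)) := by
  set p := P 0 with hp
  have hq : 0 < 1 - p := by linarith
  have hanti : Antitone P := antitone_nat_of_succ_le hmono
  have hQ : HasSum (fun n => P (n + 1)) (1 - p) := by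
    simpa [hp] using (hasSum_nat_add_iff' 1).mpr hsum
  have hQle (n : ℕ) : ((n : ℝ) + 1) * P (n + 1) ≤ 1 - p :=
    succ_mul_le_of_antitone_of_hasSum (Q := fun n => P (n + 1)) (fun n => hnonneg _)
      (fun m n h => hanti (Nat.succ_le_succ h)) hQ n
  have hhalf (n : ℕ) : P (n + 1) ≤ 2⁻¹ := by
    have h1 := hQle 0
    have h2 : P (n + 1) ≤ P 1 := hanti (by omega)
    have h3 : P 1 ≤ p := hmono 0
    norm_num at h1 ⊢
    linarith
  -- The entropy contributed by the positive symbols.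
  have hEs : Summable (fun n => -(P (n + 1) * Real.logb 2 (P (n + 1)))) :=
    ((summable_nat_add_iff 1).mpr hent).neg
  set E := ∑' n, -(P (n + 1) * Real.logb 2 (P (n + 1))) with hE
  have hEH : E ≤ -∑' n, P n * Real.logb 2 (P n) := by
    rw [hent.tsum_eq_zero_add, hE, tsum_neg]
    have := mul_nonpos_of_nonneg_of_nonpos hP0.le
      (Real.logb_nonpos one_lt_two hP0.le hP0'.le)
    linarith
  have hqE : 1 - p ≤ E := by
    refine hasSum_le (fun n => ?_) hQ hEs.hasSum
    rcases (hnonneg (n + 1)).eq_or_lt with h | h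
    · simp [← h]
    · have h1 : Real.logb 2 (P (n + 1)) ≤ -1 := by
        calc Real.logb 2 (P (n + 1)) ≤ Real.logb 2 2⁻¹ :=
              Real.logb_le_logb_of_le one_lt_two h (hhalf n)
          _ = -1 := by rw [Real.logb_inv, Real.logb_self_eq_one one_lt_two]
      nlinarith
  -- Run lengths.
  have hA (i : ℕ) : p ^ i * (L (i + 1) : ℝ) ≤
      p ^ i * ((a - b * Real.logb 2 (1 - p)) +
        b / Real.log 2 * (((i : ℝ) + 1) * (1 - p) - 1)) := by
    have h1 := hL2 (i + 1) (by omega)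
    have h2 := mul_le_mul_of_nonneg_left
      (logb_two_le_tangent hq (x := (i : ℝ) + 1) (by positivity)) hb.le
    push_cast at h1
    gcongr
    calc (L (i + 1) : ℝ) ≤ _ := h1
      _ ≤ _ := add_le_add_right h2 a
      _ = _ := by ring
  have hF := hasSum_geometric_mul_affine hP0.le hP0' (a - b * Real.logb 2 (1 - p))
    (b / Real.log 2)
  have hAs : Summable (fun i => p ^ i * (L (i + 1) : ℝ)) :=
    Summable.of_nonneg_of_le (fun i => by positivity) hA hF.summable
  have hAle := hasSum_le hA hAs.hasSum hF
  -- Positive symbols.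
  have hB (n : ℕ) : P (n + 1) * (L (n + 1) : ℝ) ≤
      P (n + 1) * (a + b * Real.logb 2 (1 - p)) +
        b * -(P (n + 1) * Real.logb 2 (P (n + 1))) := by
    rcases (hnonneg (n + 1)).eq_or_lt with h | h
    · simp [← h]
    · have h1 := hL2 (n + 1) (by omega)
      have hn : (0 : ℝ) < (n : ℝ) + 1 := by positivity
      have h2 := Real.logb_le_logb_of_le one_lt_two (mul_pos hn h) (hQle n)
      rw [Real.logb_mul hn.ne' h.ne'] at h2
      push_cast at h1
      have h3 : (L (n + 1) : ℝ) ≤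
          a + b * (Real.logb 2 (1 - p) - Real.logb 2 (P (n + 1))) :=
        h1.trans (by gcongr; linarith)
      calc _ ≤ _ := mul_le_mul_of_nonneg_left h3 h.le
        _ = _ := by ring
  have hG := (hQ.mul_right (a + b * Real.logb 2 (1 - p))).add (hEs.hasSum.mul_left b)
  have hBs : Summable (fun n => P (n + 1) * (L (n + 1) : ℝ)) :=
    Summable.of_nonneg_of_le (fun n => mul_nonneg (hnonneg _) (Nat.cast_nonneg _)) hB
      hG.summable
  have hBle := hasSum_le hB hBs.hasSum hG
  set A := ∑' i, p ^ i * (L (i + 1) : ℝ)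
  set B := ∑' n, P (n + 1) * (L (n + 1) : ℝ)
  have hinner (i : ℕ) : ∑' n, p ^ i * P (n + 1) * ((L (i + 1) : ℝ) + (L (n + 1) : ℝ)) =
      p ^ i * (L (i + 1) : ℝ) * (1 - p) + p ^ i * B := by
    rw [← ((hQ.mul_left (p ^ i * (L (i + 1) : ℝ))).add (hBs.hasSum.mul_left (p ^ i))).tsum_eq]
    exact tsum_congr fun n => by ring
  have houter : ∑' i, ∑' n, p ^ i * P (n + 1) * ((L (i + 1) : ℝ) + (L (n + 1) : ℝ)) =
      A * (1 - p) + (1 - p)⁻¹ * B := by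
    simp_rw [hinner]
    exact ((hAs.hasSum.mul_right (1 - p)).add
      ((hasSum_geometric_of_lt_one hP0.le hP0').mul_right B)).tsum_eq
  have hA' : (1 - p) * ((1 - p) * A) ≤ (1 - p) * (a - b * Real.logb 2 (1 - p)) := by
    rw [le_div_iff₀ hq] at hAle
    gcongr
    linarith
  calc _ = (1 - p) * ((1 - p) * A) + B := by
        rw [houter]
        field_simp
    _ ≤ 2 * a * (1 - p) + b * E := by linarith
    _ ≤ 2 * a * E + b * E := by gcongr
    _ = (2 * a + b) * E := by ring
    _ ≤ _ := by gcongr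
end

section
/- Let P be a decreasing probability distribution on ℕ with 0 < P(0) < 1 whose entropy series converges. Then the double series ∑_{i=0}^∞ ∑_{n=1}^∞ P(0)^i P(n) · (-log₂(P(0)^i P(n))) converges and equals H(P) · ∑_{i=0}^∞ ∑_{n=1}^∞ P(0)^i P(n) · (i+1) = H(P)/(1 - P(0)). (This is the conservation-of-entropy identity H(D_RLE) = H(P) · l̄(D_RLE) for the run-length dictionary D_RLE = {0^i n : i ≥ 0, n ≥ 1}.) -/
/-- The product of two convergent unordered real series is the sum of the products
over the product index type. -/
theorem HasSum.mul_of_real {ι κ : Type*} {f : ι → ℝ} {g : κ → ℝ} {a b : ℝ}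
    (hf : HasSum f a) (hg : HasSum g b) :
    HasSum (fun p : ι × κ => f p.1 * g p.2) (a * b) :=
  hf.mul hg (summable_mul_of_summable_norm hf.summable.norm hg.summable.norm)

/-- Conservation of entropy for the run-length dictionary.  For a DPD `P`
with `0 < P 0 < 1` and convergent entropy series, the double series
`∑_{i,n} P(0)^i P(n) · (-log₂(P(0)^i P(n)))` converges and equals
`H(P) · ∑_{i,n} P(0)^i P(n) (i+1) = H(P)/(1 - P 0)`. -/
theorem stmt_3 (P : ℕ → ℝ)
    (hnonneg : ∀ m, 0 ≤ P m)
    (hmono : ∀ m, P (m + 1) ≤ P m)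
    (hsum : HasSum P 1)
    (hP0 : 0 < P 0) (hP0' : P 0 < 1)
    (hent : Summable (fun n => P n * Real.logb 2 (P n))) :
    Summable (fun p : ℕ × ℕ =>
        P 0 ^ p.1 * P (p.2 + 1) * (-Real.logb 2 (P 0 ^ p.1 * P (p.2 + 1)))) ∧
    (∑' i : ℕ, ∑' n : ℕ, P 0 ^ i * P (n + 1) * (-Real.logb 2 (P 0 ^ i * P (n + 1))))
        = (-∑' n : ℕ, P n * Real.logb 2 (P n)) *
            ∑' i : ℕ, ∑' n : ℕ, P 0 ^ i * P (n + 1) * ((i : ℝ) + 1) ∧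
    (∑' i : ℕ, ∑' n : ℕ, P 0 ^ i * P (n + 1) * (-Real.logb 2 (P 0 ^ i * P (n + 1))))
        = (-∑' n : ℕ, P n * Real.logb 2 (P n)) / (1 - P 0) := by
  have hterm : ∀ i n : ℕ, P 0 ^ i * P (n + 1) * (-Real.logb 2 (P 0 ^ i * P (n + 1)))
      = i * P 0 ^ i * (P (n + 1) * -Real.logb 2 (P 0))
        + P 0 ^ i * -(P (n + 1) * Real.logb 2 (P (n + 1))) := by
    intro i n
    rcases eq_or_ne (P (n + 1)) 0 with h | h
    · simp [h]
    · rw [Real.logb_mul (pow_pos hP0 i).ne' h, Real.logb_pow]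
      ring
  have hgeom : HasSum (fun i : ℕ => P 0 ^ i) (1 - P 0)⁻¹ :=
    hasSum_geometric_of_lt_one hP0.le hP0'
  have hgeom_coe : HasSum (fun i : ℕ => (i : ℝ) * P 0 ^ i) (P 0 / (1 - P 0) ^ 2) :=
    hasSum_coe_mul_geometric_of_norm_lt_one (by rwa [Real.norm_of_nonneg hP0.le])
  have htail : HasSum (fun n => P (n + 1)) (1 - P 0) := by
    simpa using (hasSum_nat_add_iff' 1).mpr hsum
  have hent_tail : HasSum (fun n => P (n + 1) * Real.logb 2 (P (n + 1)))
      ((∑' n, P n * Real.logb 2 (P n)) - P 0 * Real.logb 2 (P 0)) := by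
    simpa using (hasSum_nat_add_iff' 1).mpr hent.hasSum
  have hne : 1 - P 0 ≠ 0 := (sub_pos.mpr hP0').ne'
  have hdouble : HasSum (fun p : ℕ × ℕ =>
      P 0 ^ p.1 * P (p.2 + 1) * (-Real.logb 2 (P 0 ^ p.1 * P (p.2 + 1))))
      ((-∑' n : ℕ, P n * Real.logb 2 (P n)) / (1 - P 0)) := by
    simp only [hterm]
    convert (hgeom_coe.mul_of_real (htail.mul_right (-Real.logb 2 (P 0)))).add
      (hgeom.mul_of_real hent_tail.neg) using 1
    field_simp
    ring
  have hlength : ∑' i : ℕ, ∑' n : ℕ, P 0 ^ i * P (n + 1) * ((i : ℝ) + 1) = (1 - P 0)⁻¹ := by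
    have hinner : ∀ i : ℕ, ∑' n : ℕ, P 0 ^ i * P (n + 1) * ((i : ℝ) + 1)
        = (i * P 0 ^ i + P 0 ^ i) * (1 - P 0) := by
      intro i
      rw [((htail.mul_left (P 0 ^ i)).mul_right ((i : ℝ) + 1)).tsum_eq]
      ring
    simp only [hinner]
    rw [((hgeom_coe.add hgeom).mul_right (1 - P 0)).tsum_eq]
    field_simp
    ring
  have htsum := hdouble.summable.tsum_prod.symm.trans hdouble.tsum_eq
  exact ⟨hdouble.summable, by rw [hlength, ← div_eq_mul_inv]; exact htsum, htsum⟩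
end

section
/- Let D be a countable type, let p : D → ℝ be nonnegative with ∑_{α ∈ D} p(α) = 1 and with the series ∑_{α ∈ D} -p(α)·log₂ p(α) convergent with sum H. Let φ : D → {0,1}* be a binary encoder satisfying the prefix property: for all α ≠ β in D, φ(α) is not a prefix of φ(β). Then ∑_{α ∈ D} p(α)·|φ(α)| ≥ H. (This is the inequality ∑ p(α)|φ(α)| ≥ H(D) underlying Theorem 1, which together with the conservation-of-entropy identity gives R_C ≥ H(P) for every VV code satisfying the prefix property.) -/
open InformationTheory

/-- A prefix-free code without the empty word is uniquely decodable. -/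
theorem uniquelyDecodable_of_prefix_free {A : Type*} {S : Set (List A)} (hnil : [] ∉ S)
    (hpre : ∀ u ∈ S, ∀ v ∈ S, u <+: v → u = v) : UniquelyDecodable S := by
  intro L₁
  induction L₁ with
  | nil =>
    intro L₂ _ h₂ h
    cases L₂ with
    | nil => rfl
    | cons v L₂ =>
      have hv : v = [] := (by simpa using h.symm : v = [] ∧ _).1
      exact absurd (hv ▸ h₂ v (by simp)) hnil
  | cons u L₁ ih =>
    intro L₂ h₁ h₂ h
    cases L₂ with
    | nil =>
      have hu : u = [] := (by simpa using h : u = [] ∧ _).1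
      exact absurd (hu ▸ h₁ u (by simp)) hnil
    | cons v L₂ =>
      rw [List.flatten_cons, List.flatten_cons] at h
      have hu := h₁ u (by simp)
      have hv := h₂ v (by simp)
      have huv : u = v := by
        rcases List.prefix_or_prefix_of_prefix (List.prefix_append u L₁.flatten)
          (h ▸ List.prefix_append v L₂.flatten) with h' | h'
        · exact hpre u hu v hv h'
        · exact (hpre v hv u hu h').symm
      subst huv
      rw [ih L₂ (fun w hw => h₁ w (by simp [hw])) (fun w hw => h₂ w (by simp [hw]))
        (List.append_cancel_left h)]

/-- Kraft's inequality for finite subfamilies of a binary prefix code. -/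
theorem sum_half_pow_length_le_one_of_prefix_free {D : Type*} {φ : D → List Bool}
    (hprefix : ∀ α β : D, α ≠ β → ¬ (φ α <+: φ β)) (s : Finset D) :
    ∑ α ∈ s, (1 / 2 : ℝ) ^ (φ α).length ≤ 1 := by
  classical
  by_cases hnil : ∃ α ∈ s, φ α = []
  · obtain ⟨α, hα, hα'⟩ := hnil
    have hs : s = {α} := by
      refine Finset.eq_singleton_iff_unique_mem.mpr ⟨hα, fun β _ => ?_⟩
      by_contra hne
      exact hprefix α β (Ne.symm hne) (hα' ▸ List.nil_prefix)
    simp [hs, hα']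
  · have hinj : Function.Injective φ := by
      intro α β h
      by_contra hne
      exact hprefix α β hne (h ▸ List.prefix_rfl)
    have hdec : UniquelyDecodable ((s.image φ : Finset (List Bool)) : Set (List Bool)) := by
      refine uniquelyDecodable_of_prefix_free (by simpa using hnil) ?_
      intro u hu v hv huv
      obtain ⟨α, -, rfl⟩ := Finset.mem_image.mp (Finset.mem_coe.mp hu)
      obtain ⟨β, -, rfl⟩ := Finset.mem_image.mp (Finset.mem_coe.mp hv)
      by_contra hne
      exact hprefix α β (fun h => hne (h ▸ rfl)) huv
    have hkraft := kraft_mcmillan_inequality hdec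
    rw [Finset.sum_image hinj.injOn] at hkraft
    simpa using hkraft

/-- The pointwise form of Gibbs' inequality against the weight `2⁻ⁿ`. -/
theorem neg_mul_logb_two_le {x : ℝ} (hx : 0 ≤ x) (n : ℕ) :
    -(x * Real.logb 2 x) ≤ x * n + ((1 / 2 : ℝ) ^ n - x) / Real.log 2 := by
  have hlog : 0 < Real.log 2 := Real.log_pos one_lt_two
  rcases hx.eq_or_lt with rfl | hx
  · simp only [zero_mul, neg_zero, sub_zero, zero_add]
    positivity
  · have hq : (0 : ℝ) < (1 / 2) ^ n := by positivity
    have hle := mul_le_mul_of_nonneg_left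
      (Real.log_le_sub_one_of_pos (div_pos hq hx)) hx.le
    have hlogq : Real.log ((1 / 2 : ℝ) ^ n) = -(n * Real.log 2) := by
      simp [Real.log_pow]
    rw [Real.log_div hq.ne' hx.ne', hlogq, mul_sub x (_ / x), mul_div_cancel₀ _ hx.ne'] at hle
    rw [Real.logb, ← sub_nonneg]
    have heq : x * n + ((1 / 2 : ℝ) ^ n - x) / Real.log 2 - -(x * (Real.log x / Real.log 2))
        = (x * n * Real.log 2 + ((1 / 2 : ℝ) ^ n - x) + x * Real.log x) / Real.log 2 := by
      field_simp
      ring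
    rw [heq]
    exact div_nonneg (by linarith) hlog.le

/-- Let `D` be a countable type, `p : D → ℝ` a probability distribution
whose entropy series converges with sum `H`, and `φ : D → List Bool` a binary encoder
satisfying the prefix property.  Then `∑_α p(α)·|φ(α)| ≥ H` (the sum taken in `ℝ≥0∞`
so that a divergent sum counts as `∞`). -/
theorem stmt_4 (D : Type*) [Countable D] (p : D → ℝ)
    (hnonneg : ∀ α, 0 ≤ p α)
    (hsum : HasSum p 1)
    (hent : Summable (fun α => -(p α * Real.logb 2 (p α))))
    (φ : D → List Bool)
    (hprefix : ∀ α β : D, α ≠ β → ¬ (φ α <+: φ β)) :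
    ENNReal.ofReal (∑' α : D, -(p α * Real.logb 2 (p α)))
      ≤ ∑' α : D, ENNReal.ofReal (p α * (φ α).length) := by
  have hnn : ∀ α, 0 ≤ p α * (φ α).length := fun α => mul_nonneg (hnonneg α) (Nat.cast_nonneg _)
  by_cases htop : ∑' α : D, ENNReal.ofReal (p α * (φ α).length) = ⊤
  · rw [htop]
    exact le_top
  have hlen : Summable fun α => p α * ((φ α).length : ℝ) := by
    simpa [ENNReal.toReal_ofReal (hnn _)] using ENNReal.summable_toReal htop
  have hkraft := sum_half_pow_length_le_one_of_prefix_free hprefix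
  have hq : Summable fun α => (1 / 2 : ℝ) ^ (φ α).length :=
    summable_of_sum_le (fun _ => by positivity) hkraft
  have hq_le : ∑' α, (1 / 2 : ℝ) ^ (φ α).length ≤ 1 := hq.tsum_le_of_sum_le hkraft
  have hgap := (hq.sub hsum.summable).div_const (Real.log 2)
  rw [← ENNReal.ofReal_tsum_of_nonneg hnn hlen]
  refine ENNReal.ofReal_le_ofReal ?_
  calc ∑' α, -(p α * Real.logb 2 (p α))
      ≤ ∑' α, (p α * (φ α).length + ((1 / 2 : ℝ) ^ (φ α).length - p α) / Real.log 2) :=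
        hent.tsum_le_tsum (fun α => neg_mul_logb_two_le (hnonneg α) _) (hlen.add hgap)
    _ = ∑' α, p α * (φ α).length
          + (∑' α, (1 / 2 : ℝ) ^ (φ α).length - 1) / Real.log 2 := by
        rw [hlen.tsum_add hgap, tsum_div_const, hq.tsum_sub hsum.summable, hsum.tsum_eq]
    _ ≤ ∑' α, p α * (φ α).length := by
        have := div_nonpos_of_nonpos_of_nonneg (sub_nonpos.mpr hq_le)
          (Real.log_pos one_lt_two).le
        linarith
end

section
/- Let P be a decreasing probability distribution on ℕ. Then for every integer m ≥ 1, ∑_{j=1}^m P(j) ≤ m/(m+1). -/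
/-- For a DPD `P` on ℕ and every `m ≥ 1`, `∑_{j=1}^m P(j) ≤ m/(m+1)`. -/
theorem stmt_5 (P : ℕ → ℝ)
    (hnonneg : ∀ m, 0 ≤ P m)
    (hmono : ∀ m, P (m + 1) ≤ P m)
    (hsum : HasSum P 1)
    (m : ℕ) (hm : 1 ≤ m) :
    ∑ j ∈ Finset.Icc 1 m, P j ≤ (m : ℝ) / (m + 1) := by
  have hanti : Antitone P := antitone_nat_of_succ_le hmono
  have hle : ∑ j ∈ Finset.Icc 1 m, P j ≤ m * P 0 := by
    simpa using Finset.sum_le_card_nsmul (Finset.Icc 1 m) P (P 0)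
      fun j _ => hanti (Nat.zero_le j)
  have htotal : P 0 + ∑ j ∈ Finset.Icc 1 m, P j ≤ 1 := by
    rw [← Finset.sum_insert (by simp)]
    exact sum_le_hasSum _ (fun j _ => hnonneg j) hsum
  have hm0 : (0 : ℝ) ≤ m := m.cast_nonneg
  rw [le_div_iff₀ (by positivity)]
  nlinarith [mul_le_mul_of_nonneg_left htotal hm0]
end

section
/- Let P be a decreasing probability distribution on ℕ and let m ≥ 1 be an integer with P(m) > 0. Then B_m := ∑_{j=1}^m (1 + log₂ j + log₂ P(j)) ≤ 0. -/
/-- `2 ^ m * m! ≤ 2 * m ^ m` for `m ≥ 1`. -/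
theorem two_pow_mul_factorial_le {m : ℕ} (hm : 1 ≤ m) :
    2 ^ m * m.factorial ≤ 2 * m ^ m := by
  induction m, hm using Nat.le_induction with
  | base => simp
  | succ n hn ih =>
    have bernoulli : 2 * n ^ n ≤ (n + 1) ^ n := by
      have h := pow_add_mul_le_add_pow n.zero_le (b := 1) (by omega) n
      rw [mul_one, Nat.cast_id, mul_pow_sub_one (by omega)] at h
      omega
    calc 2 ^ (n + 1) * (n + 1).factorial
        = 2 * (n + 1) * (2 ^ n * n.factorial) := by
          rw [Nat.factorial_succ]; ring
      _ ≤ 2 * (n + 1) * (2 * n ^ n) := by gcongr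
      _ ≤ 2 * (n + 1) * (n + 1) ^ n := by gcongr
      _ = 2 * (n + 1) ^ (n + 1) := by ring

/-- The tangent-line bound `log x ≤ x - 1`, scaled by `c` and summed over `1, …, m` with the first
term counted twice inside the logarithm. -/
theorem sum_log_add_log_two_le {P : ℕ → ℝ} {c : ℝ} (hc : 0 < c) {m : ℕ} (hm : 1 ≤ m)
    (hpos : ∀ j ≤ m, 0 < P j) :
    ∑ j ∈ Finset.Icc 1 m, Real.log (P j) + Real.log 2 + m * Real.log c ≤
      c * (P 1 + ∑ j ∈ Finset.Icc 1 m, P j) - m := by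
  induction m, hm using Nat.le_induction with
  | base =>
    have h1 := hpos 1 le_rfl
    have h := Real.log_le_sub_one_of_pos (show 0 < P 1 * 2 * c by positivity)
    rw [Real.log_mul (by positivity) hc.ne', Real.log_mul h1.ne' two_ne_zero] at h
    simp only [Finset.Icc_self, Finset.sum_singleton, Nat.cast_one]
    linarith
  | succ n hn ih =>
    have h1 := hpos (n + 1) le_rfl
    have h := Real.log_le_sub_one_of_pos (mul_pos h1 hc)
    rw [Real.log_mul h1.ne' hc.ne'] at h
    have := ih fun j hj => hpos j (hj.trans n.le_succ)
    rw [Finset.sum_Icc_succ_top (by omega), Finset.sum_Icc_succ_top (by omega)]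
    push_cast
    linarith

theorem sum_log_Icc_eq_log_factorial (m : ℕ) :
    ∑ j ∈ Finset.Icc 1 m, Real.log j = Real.log m.factorial := by
  induction m with
  | zero => simp
  | succ n ih =>
    rw [Finset.sum_Icc_succ_top (by omega), ih, Nat.factorial_succ, Nat.cast_mul,
      Real.log_mul (by positivity) (by positivity), add_comm]

/-- For a DPD `P` on ℕ and `m ≥ 1` with `P m > 0`,
`B_m = ∑_{j=1}^m (1 + log₂ j + log₂ P(j)) ≤ 0`. -/
theorem stmt_8 (P : ℕ → ℝ)
    (hnonneg : ∀ m, 0 ≤ P m)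
    (hmono : ∀ m, P (m + 1) ≤ P m)
    (hsum : HasSum P 1)
    (m : ℕ) (hm : 1 ≤ m) (hPm : 0 < P m) :
    ∑ j ∈ Finset.Icc 1 m, (1 + Real.logb 2 j + Real.logb 2 (P j)) ≤ 0 := by
  have hanti : Antitone P := antitone_nat_of_succ_le hmono
  have hm0 : (0 : ℝ) < m := by exact_mod_cast hm
  have hmass : P 1 + ∑ j ∈ Finset.Icc 1 m, P j ≤ 1 := by
    have h := sum_le_hasSum (insert 0 (Finset.Icc 1 m)) (fun i _ => hnonneg i) hsum
    rw [Finset.sum_insert (by simp)] at h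
    linarith [hmono 0]
  have hlogP := sum_log_add_log_two_le hm0 hm fun j hj => hPm.trans_le (hanti hj)
  have hfact : m * Real.log 2 + Real.log m.factorial ≤ Real.log 2 + m * Real.log m := by
    have hf : (0 : ℝ) < m.factorial := by exact_mod_cast m.factorial_pos
    rw [← Real.log_pow, ← Real.log_pow, ← Real.log_mul (by positivity) hf.ne',
      ← Real.log_mul two_ne_zero (by positivity)]
    exact Real.log_le_log (by positivity) (by exact_mod_cast two_pow_mul_factorial_le hm)
  have hlog2 : 0 < Real.log 2 := Real.log_pos one_lt_two
  have hrew : ∑ j ∈ Finset.Icc 1 m, (1 + Real.logb 2 j + Real.logb 2 (P j)) =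
      (m * Real.log 2 + Real.log m.factorial + ∑ j ∈ Finset.Icc 1 m, Real.log (P j)) /
        Real.log 2 := by
    simp only [Real.logb, Finset.sum_add_distrib, ← Finset.sum_div, sum_log_Icc_eq_log_factorial,
      Finset.sum_const, Nat.card_Icc, Nat.add_sub_cancel, nsmul_eq_mul, mul_one]
    field_simp
  rw [hrew]
  refine div_nonpos_of_nonpos_of_nonneg ?_ hlog2.le
  linarith [mul_le_mul_of_nonneg_left hmass hm0.le]
end

section
/- Let P be a decreasing probability distribution on ℕ. Then for every integer m ≥ 1, S_m := ∑_{j=1}^m P(j)·(1 + log₂ j + log₂ P(j)) ≤ 0. -/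
open Finset

/-- Telescoping sum of consecutive differences over an interval. -/
lemma sum_Icc_sub_succ (Q : ℕ → ℝ) {j m : ℕ} (h : j ≤ m) :
    ∑ n ∈ Icc j m, (Q n - Q (n + 1)) = Q j - Q (m + 1) := by
  induction m, h using Nat.le_induction with
  | base => simp
  | succ k hk ih => rw [sum_Icc_succ_top (by omega), ih]; ring

/-- Summation by parts against the weights `n + 1`. -/
lemma sum_range_succ_mul_sub_succ (Q : ℕ → ℝ) (M : ℕ) :
    ∑ n ∈ range M, ((n : ℝ) + 1) * (Q n - Q (n + 1)) = ∑ n ∈ range M, Q n - M * Q M := by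
  induction M with
  | zero => simp
  | succ k ih => rw [sum_range_succ, sum_range_succ, ih]; push_cast; ring

/-- The logarithmic form of `2 ^ n * n! ≤ (n + 1) ^ n`. -/
lemma sum_log_two_mul_div_nonpos (n : ℕ) :
    ∑ j ∈ Icc 1 n, (Real.log 2 + Real.log j - Real.log (n + 1)) ≤ 0 := by
  have hn : (0 : ℝ) < n + 1 := by positivity
  have hsum : ∀ k : ℕ, ∑ j ∈ Icc 1 k, (2 * (j : ℝ) / (n + 1) - 1)
      = k * (k + 1) / (n + 1) - k := by
    intro k
    induction k with
    | zero => simp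
    | succ k ih =>
      rw [sum_Icc_succ_top (by omega), ih]
      push_cast
      field_simp
      ring
  calc ∑ j ∈ Icc 1 n, (Real.log 2 + Real.log j - Real.log (n + 1))
      ≤ ∑ j ∈ Icc 1 n, (2 * (j : ℝ) / (n + 1) - 1) := by
        refine sum_le_sum fun j hj => ?_
        have hj : (0 : ℝ) < j := by exact_mod_cast (mem_Icc.1 hj).1
        rw [← Real.log_mul (by norm_num) hj.ne', ← Real.log_div (by positivity) hn.ne']
        exact Real.log_le_sub_one_of_pos (by positivity)
    _ = 0 := by rw [hsum]; field_simp; ring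

/-- The tangent line inequality for `x * log x` at `p`, evaluated at `x = 1 / a` and scaled
by `a`. -/
lemma one_add_log_sub_mul_le_neg_log {p a : ℝ} (hp : 0 < p) (ha : 0 < a) :
    1 + Real.log p - a * p ≤ -Real.log a := by
  have h := Real.log_le_sub_one_of_pos (mul_pos ha hp)
  rw [Real.log_mul ha.ne' hp.ne'] at h
  linarith

/-- Log-sum inequality for the decomposition of a decreasing sequence of mass at most one,
vanishing at `m + 1`, into uniform distributions on initial segments. -/
lemma mul_log_le_sum_sub_mul {Q : ℕ → ℝ} {m : ℕ} (hQ : ∀ n, Q (n + 1) ≤ Q n)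
    (hm : Q (m + 1) = 0) (hsum : ∑ n ∈ range (m + 1), Q n ≤ 1) {j : ℕ} (hj : j ≤ m) (c : ℝ) :
    Q j * (c + Real.log (Q j)) ≤
      ∑ n ∈ Icc j m, (Q n - Q (n + 1)) * (c - Real.log (n + 1)) := by
  have hd : ∀ n, 0 ≤ Q n - Q (n + 1) := fun n => sub_nonneg.2 (hQ n)
  have htel : ∑ n ∈ Icc j m, (Q n - Q (n + 1)) = Q j := by
    rw [sum_Icc_sub_succ Q hj, hm, sub_zero]
  have hnonneg : 0 ≤ Q j := htel ▸ sum_nonneg fun n _ => hd n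
  rcases hnonneg.eq_or_lt with h0 | hp
  · have hz : ∀ n ∈ Icc j m, Q n - Q (n + 1) = 0 :=
      (sum_eq_zero_iff_of_nonneg fun n _ => hd n).1 (htel.trans h0.symm)
    rw [← h0, zero_mul, sum_eq_zero fun n hn => by rw [hz n hn, zero_mul]]
  have hmass : ∑ n ∈ Icc j m, ((n : ℝ) + 1) * (Q n - Q (n + 1)) ≤ 1 := by
    calc _ ≤ ∑ n ∈ range (m + 1), ((n : ℝ) + 1) * (Q n - Q (n + 1)) := by
          refine sum_le_sum_of_subset_of_nonneg (fun n hn => ?_)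
            fun n _ _ => mul_nonneg (by positivity) (hd n)
          rw [mem_Icc] at hn
          rw [mem_range]
          omega
      _ ≤ 1 := by rw [sum_range_succ_mul_sub_succ, hm]; simpa using hsum
  calc Q j * (c + Real.log (Q j))
      ≤ Q j * (c + 1 + Real.log (Q j))
        - (∑ n ∈ Icc j m, ((n : ℝ) + 1) * (Q n - Q (n + 1))) * Q j := by nlinarith
    _ = (∑ n ∈ Icc j m, (Q n - Q (n + 1))) * (c + 1 + Real.log (Q j))
        - (∑ n ∈ Icc j m, ((n : ℝ) + 1) * (Q n - Q (n + 1))) * Q j := by rw [htel]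
    _ = ∑ n ∈ Icc j m,
        (Q n - Q (n + 1)) * (c + (1 + Real.log (Q j) - ((n : ℝ) + 1) * Q j)) := by
        rw [sum_mul, sum_mul, ← sum_sub_distrib]
        exact sum_congr rfl fun n _ => by ring
    _ ≤ _ := by
        refine sum_le_sum fun n _ => mul_le_mul_of_nonneg_left ?_ (hd n)
        have := one_add_log_sub_mul_le_neg_log hp (a := (n : ℝ) + 1) (by positivity)
        linarith

/-- The claim in natural logarithms for a truncated decreasing sequence of mass at most one. -/
lemma sum_mul_log_nonpos {Q : ℕ → ℝ} {m : ℕ} (hQ : ∀ n, Q (n + 1) ≤ Q n)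
    (hm : Q (m + 1) = 0) (hsum : ∑ n ∈ range (m + 1), Q n ≤ 1) :
    ∑ j ∈ Icc 1 m, Q j * (Real.log 2 + Real.log j + Real.log (Q j)) ≤ 0 := by
  calc _ ≤ ∑ j ∈ Icc 1 m, ∑ n ∈ Icc j m,
        (Q n - Q (n + 1)) * (Real.log 2 + Real.log j - Real.log (n + 1)) :=
        sum_le_sum fun j hj => mul_log_le_sum_sub_mul hQ hm hsum (mem_Icc.1 hj).2 _
    _ = ∑ n ∈ Icc 1 m, ∑ j ∈ Icc 1 n,
        (Q n - Q (n + 1)) * (Real.log 2 + Real.log j - Real.log (n + 1)) :=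
        sum_comm' fun j n => by simp only [mem_Icc]; omega
    _ ≤ 0 := by
        refine sum_nonpos fun n _ => ?_
        rw [← mul_sum]
        exact mul_nonpos_of_nonneg_of_nonpos (sub_nonneg.2 (hQ n))
          (sum_log_two_mul_div_nonpos n)

/-- For a DPD `P` on ℕ and every `m ≥ 1`,
`S_m = ∑_{j=1}^m P(j)·(1 + log₂ j + log₂ P(j)) ≤ 0`. -/
theorem stmt_9 (P : ℕ → ℝ)
    (hnonneg : ∀ m, 0 ≤ P m)
    (hmono : ∀ m, P (m + 1) ≤ P m)
    (hsum : HasSum P 1)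
    (m : ℕ) (hm : 1 ≤ m) :
    ∑ j ∈ Finset.Icc 1 m, P j * (1 + Real.logb 2 j + Real.logb 2 (P j)) ≤ 0 := by
  have hlog : 0 < Real.log 2 := Real.log_pos (by norm_num)
  have key := sum_mul_log_nonpos (Q := fun n => if n ≤ m then P n else 0) (m := m)
    (fun n => by
      have := hmono n
      have := hnonneg n
      split_ifs <;> first | assumption | omega | rfl)
    (by simp)
    (by
      rw [sum_congr rfl fun n hn => if_pos (Nat.lt_succ_iff.1 (mem_range.1 hn))]
      exact sum_le_hasSum _ (fun n _ => hnonneg n) hsum)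
  have hrw : ∑ j ∈ Icc 1 m, P j * (1 + Real.logb 2 j + Real.logb 2 (P j)) =
      (∑ j ∈ Icc 1 m, (if j ≤ m then P j else 0) *
        (Real.log 2 + Real.log j + Real.log (if j ≤ m then P j else 0))) / Real.log 2 := by
    rw [sum_div]
    refine sum_congr rfl fun j hj => ?_
    rw [if_pos (mem_Icc.1 hj).2, Real.logb, Real.logb]
    field_simp
  rw [hrw]
  exact div_nonpos_of_nonpos_of_nonneg key hlog.le
end

section
/- Let P be a decreasing probability distribution on ℕ with 0 < P(0) < 1 whose entropy series converges, and suppose L : ℕ⁺ → ℕ satisfies 1 ≤ L(n) ≤ b + 2b·log₂ n for all n ≥ 1, where b is a positive constant. Then (1 - P(0)) · ∑_{i=0}^∞ ∑_{n=1}^∞ P(0)^i P(n)(L(i+1) + L(n)) ≤ 2b · H(P). (Equivalently, the coding rate R_C of the RLE-based VV code C = (D_RLE, φ_L) satisfies R_C / H(P) ≤ 2b.) -/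
/-- On `[0, 1]` the concave function `log₂ (1 + t)` lies above its chord. -/
lemma le_logb_two_one_add {t : ℝ} (h0 : 0 ≤ t) (h1 : t ≤ 1) : t ≤ Real.logb 2 (1 + t) := by
  rw [Real.le_logb_iff_rpow_le (by norm_num) (by linarith)]
  have h := rpow_one_add_le_one_add_mul_self (s := 1) (by norm_num) h0 h1
  norm_num at h
  exact h

lemma mul_logb_add_le {S x c : ℝ} (hx : 0 ≤ x) (hxS : x ≤ S) (hc : 0 < c) (hcx : c * x ≤ S + x) :
    x * (Real.logb 2 c + Real.logb 2 x) + S * Real.logb 2 S + x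
      ≤ (S + x) * Real.logb 2 (S + x) := by
  rcases hx.eq_or_lt with rfl | hx
  · simp
  have hS : 0 < S := hx.trans_le hxS
  have hlog : Real.logb 2 c + Real.logb 2 x ≤ Real.logb 2 (S + x) := by
    rw [← Real.logb_mul hc.ne' hx.ne']
    exact Real.logb_le_logb_of_le (by norm_num) (by positivity) hcx
  have hratio : Real.logb 2 S + x / S ≤ Real.logb 2 (S + x) := by
    have h := le_logb_two_one_add (div_nonneg hx.le hS.le) ((div_le_one hS).2 hxS)
    have heq : S + x = S * (1 + x / S) := by field_simp
    rw [heq, Real.logb_mul hS.ne' (by positivity)]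
    linarith
  have h1 := mul_le_mul_of_nonneg_left hlog hx.le
  have h2 := mul_le_mul_of_nonneg_left hratio hS.le
  have h3 : S * (x / S) = x := by field_simp
  nlinarith

lemma Antitone.mul_le_sum_range {Q : ℕ → ℝ} (hQ : Antitone Q) (n : ℕ) :
    ((n : ℝ) + 1) * Q n ≤ ∑ m ∈ Finset.range (n + 1), Q m := by
  have h := Finset.card_nsmul_le_sum (Finset.range (n + 1)) Q (Q n)
    fun m hm => hQ (Nat.lt_succ_iff.1 (Finset.mem_range.1 hm))
  simpa using h

lemma Antitone.sum_mul_logb_le {Q : ℕ → ℝ} (hQ : Antitone Q) (h0 : ∀ n, 0 ≤ Q n) (n : ℕ) :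
    ∑ m ∈ Finset.range (n + 1), Q m * (Real.logb 2 ((m : ℝ) + 1) + Real.logb 2 (Q m))
      ≤ (∑ m ∈ Finset.range (n + 1), Q m) * Real.logb 2 (∑ m ∈ Finset.range (n + 1), Q m)
        - (∑ m ∈ Finset.range (n + 1), Q m) + Q 0 := by
  induction n with
  | zero => simp
  | succ n ih =>
    rw [Finset.sum_range_succ, Finset.sum_range_succ Q (n + 1)]
    have hS := hQ.mul_le_sum_range (n + 1)
    rw [Finset.sum_range_succ Q (n + 1)] at hS
    have hle : Q (n + 1) ≤ ∑ m ∈ Finset.range (n + 1), Q m :=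
      (hQ (Nat.zero_le _)).trans
        (Finset.single_le_sum (fun m _ => h0 m) (Finset.mem_range.2 n.succ_pos))
    have h := mul_logb_add_le (h0 (n + 1)) hle (by positivity) hS
    linarith

/-- For a decreasing nonnegative sequence of total mass `q ≤ 1` and finite entropy, the
expectation of `log₂ n` (with `n` counted from one) converges. -/
lemma Antitone.summable_mul_logb {Q : ℕ → ℝ} (hQ : Antitone Q) (h0 : ∀ n, 0 ≤ Q n) {q : ℝ}
    (hq : HasSum Q q) (hq1 : q ≤ 1) (hent : Summable fun n => Q n * Real.logb 2 (Q n)) :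
    Summable fun n : ℕ => Q n * Real.logb 2 ((n : ℝ) + 1) := by
  refine Summable.of_nonneg_of_le (fun n => mul_nonneg (h0 n)
    (Real.logb_nonneg (by norm_num) (by linarith [n.cast_nonneg (α := ℝ)]))) (fun n => ?_) hent.neg
  rcases (h0 n).eq_or_lt with h | h
  · simp [← h]
  have h1 : ((n : ℝ) + 1) * Q n ≤ 1 :=
    (hQ.mul_le_sum_range n).trans ((sum_le_hasSum _ (fun m _ => h0 m) hq).trans hq1)
  have h2 : Real.logb 2 (((n : ℝ) + 1) * Q n) ≤ 0 :=
    Real.logb_nonpos (by norm_num) (by positivity) h1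
  rw [Real.logb_mul (by positivity) h.ne'] at h2
  nlinarith

lemma Antitone.tsum_mul_logb_le {Q : ℕ → ℝ} (hQ : Antitone Q) (h0 : ∀ n, 0 ≤ Q n) {q : ℝ}
    (hq : HasSum Q q) (hq0 : 0 < q) (hq1 : q ≤ 1)
    (hent : Summable fun n => Q n * Real.logb 2 (Q n)) :
    ∑' n : ℕ, Q n * Real.logb 2 ((n : ℝ) + 1) + ∑' n, Q n * Real.logb 2 (Q n)
      ≤ q * Real.logb 2 q - q + Q 0 := by
  have hsum := (hQ.summable_mul_logb h0 hq hq1 hent).hasSum.add hent.hasSum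
  have hleft := hsum.tendsto_sum_nat.comp (Filter.tendsto_add_atTop_nat 1)
  have hS := hq.tendsto_sum_nat.comp (Filter.tendsto_add_atTop_nat 1)
  have hlog := hS.log hq0.ne'
  refine le_of_tendsto_of_tendsto' hleft
    (((hS.mul (hlog.div_const (Real.log 2))).sub hS).add_const (Q 0)) fun n => ?_
  simpa only [Function.comp_apply, ← mul_add, Real.logb] using hQ.sum_mul_logb_le h0 n

lemma hasSum_succ_mul_geometric {p : ℝ} (h0 : 0 ≤ p) (h1 : p < 1) :
    HasSum (fun i : ℕ => p ^ i * ((i : ℝ) + 1)) (1 / (1 - p) ^ 2) := by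
  have hp : ‖p‖ < 1 := by rwa [Real.norm_of_nonneg h0]
  have h := (hasSum_coe_mul_geometric_of_norm_lt_one hp).add (hasSum_geometric_of_lt_one h0 h1)
  have hq : 1 - p ≠ 0 := by linarith
  have heq : p / (1 - p) ^ 2 + (1 - p)⁻¹ = 1 / (1 - p) ^ 2 := by field_simp; ring
  rw [heq] at h
  exact h.congr_fun fun i => by ring

/-- Jensen's inequality for the logarithm and a geometric distribution. -/
lemma summable_geometric_mul_logb {p : ℝ} (h0 : 0 ≤ p) (h1 : p < 1) :
    Summable (fun i : ℕ => p ^ i * Real.logb 2 ((i : ℝ) + 1)) ∧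
      (1 - p) * ∑' i : ℕ, p ^ i * Real.logb 2 ((i : ℝ) + 1) ≤ -Real.logb 2 (1 - p) := by
  have hq : 0 < 1 - p := by linarith
  have hlog2 : 0 < Real.log 2 := Real.log_pos (by norm_num)
  have hle : ∀ i : ℕ, p ^ i * Real.logb 2 ((i : ℝ) + 1) ≤
      p ^ i * ((i : ℝ) + 1) * ((1 - p) / Real.log 2)
        + p ^ i * (-Real.logb 2 (1 - p) - 1 / Real.log 2) := fun i => by
    have h := Real.log_le_sub_one_of_pos (x := ((i : ℝ) + 1) * (1 - p)) (by positivity)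
    rw [Real.log_mul (by positivity) hq.ne'] at h
    have h' : Real.logb 2 ((i : ℝ) + 1) ≤
        ((i : ℝ) + 1) * ((1 - p) / Real.log 2) + (-Real.logb 2 (1 - p) - 1 / Real.log 2) := by
      simp only [Real.logb]
      rw [← sub_nonneg]
      have : ((i : ℝ) + 1) * ((1 - p) / Real.log 2) + (-(Real.log (1 - p) / Real.log 2)
          - 1 / Real.log 2) - Real.log ((i : ℝ) + 1) / Real.log 2
          = (((i : ℝ) + 1) * (1 - p) - 1 - (Real.log ((i : ℝ) + 1) + Real.log (1 - p)))
            / Real.log 2 := by ring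
      rw [this]
      exact div_nonneg (by linarith) hlog2.le
    have := mul_le_mul_of_nonneg_left h' (pow_nonneg h0 i)
    linarith
  have hbound := ((hasSum_succ_mul_geometric h0 h1).mul_right ((1 - p) / Real.log 2)).add
    ((hasSum_geometric_of_lt_one h0 h1).mul_right (-Real.logb 2 (1 - p) - 1 / Real.log 2))
  have hs : Summable fun i : ℕ => p ^ i * Real.logb 2 ((i : ℝ) + 1) :=
    Summable.of_nonneg_of_le (fun i => mul_nonneg (pow_nonneg h0 i)
      (Real.logb_nonneg (by norm_num) (by linarith [i.cast_nonneg (α := ℝ)]))) hle hbound.summable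
  refine ⟨hs, (mul_le_mul_of_nonneg_left (hasSum_le hle hs.hasSum hbound) hq.le).trans_eq ?_⟩
  field_simp
  ring

/-- The expected value of a length function bounded by `b + 2b log₂ n`, under nonnegative
weights of total mass `s`. -/
lemma summable_mul_length {w : ℕ → ℝ} (hw : ∀ n, 0 ≤ w n) {s : ℝ} (hs : HasSum w s)
    (hlog : Summable fun n : ℕ => w n * Real.logb 2 ((n : ℝ) + 1)) {b : ℝ} {L : ℕ → ℕ}
    (hL : ∀ n : ℕ, 1 ≤ n → (L n : ℝ) ≤ b + 2 * b * Real.logb 2 n) :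
    Summable (fun n : ℕ => w n * (L (n + 1) : ℝ)) ∧
      ∑' n : ℕ, w n * (L (n + 1) : ℝ)
        ≤ s * b + 2 * b * ∑' n : ℕ, w n * Real.logb 2 ((n : ℝ) + 1) := by
  have hle : ∀ n : ℕ, w n * (L (n + 1) : ℝ)
      ≤ w n * b + 2 * b * (w n * Real.logb 2 ((n : ℝ) + 1)) := fun n => by
    have h := mul_le_mul_of_nonneg_left (hL (n + 1) (by omega)) (hw n)
    push_cast at h
    linarith
  have hbound := (hs.mul_right b).add (hlog.hasSum.mul_left (2 * b))
  have hsum : Summable fun n : ℕ => w n * (L (n + 1) : ℝ) :=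
    Summable.of_nonneg_of_le (fun n => mul_nonneg (hw n) (Nat.cast_nonneg _)) hle hbound.summable
  exact ⟨hsum, hasSum_le hle hsum.hasSum hbound⟩

lemma tsum_tsum_mul_add {v w f g : ℕ → ℝ} {s t : ℝ} (hv : HasSum v s) (hw : HasSum w t)
    (hf : Summable fun i => v i * f i) (hg : Summable fun n => w n * g n) :
    ∑' i, ∑' n, v i * w n * (f i + g n)
      = t * ∑' i, v i * f i + s * ∑' n, w n * g n := by
  have hinner : ∀ i, ∑' n, v i * w n * (f i + g n)
      = v i * f i * t + v i * ∑' n, w n * g n := fun i => by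
    rw [← ((hw.mul_left (v i * f i)).add (hg.hasSum.mul_left (v i))).tsum_eq]
    exact tsum_congr fun n => by ring
  simp only [hinner]
  rw [((hf.hasSum.mul_right t).add (hv.mul_right _)).tsum_eq, mul_comm t]

/-- For a DPD `P` with `0 < P 0 < 1` and convergent entropy series, and
a length function `L` with `1 ≤ L n ≤ b + 2b·log₂ n` for `n ≥ 1` (`b > 0`),
the coding rate of the RLE-based VV code satisfies `R_C ≤ 2b·H(P)`, i.e.
`(1 - P 0) · ∑_{i,n} P(0)^i P(n)(L(i+1)+L(n)) ≤ 2b·H(P)`. -/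
theorem stmt_12 (P : ℕ → ℝ)
    (hnonneg : ∀ m, 0 ≤ P m)
    (hmono : ∀ m, P (m + 1) ≤ P m)
    (hsum : HasSum P 1)
    (hP0 : 0 < P 0) (hP0' : P 0 < 1)
    (hent : Summable (fun n => P n * Real.logb 2 (P n)))
    (b : ℝ) (hb : 0 < b)
    (L : ℕ → ℕ)
    (hL1 : ∀ n : ℕ, 1 ≤ n → 1 ≤ L n)
    (hL2 : ∀ n : ℕ, 1 ≤ n → (L n : ℝ) ≤ b + 2 * b * Real.logb 2 n) :
    (1 - P 0) *
        ∑' i : ℕ, ∑' n : ℕ, P 0 ^ i * P (n + 1) * ((L (i + 1) : ℝ) + (L (n + 1) : ℝ))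
      ≤ 2 * b * (-∑' n : ℕ, P n * Real.logb 2 (P n)) := by
  have hanti : Antitone fun n => P (n + 1) := antitone_nat_of_succ_le fun n => hmono (n + 1)
  have hQ : HasSum (fun n => P (n + 1)) (1 - P 0) := by
    simpa using (hasSum_nat_add_iff' 1).2 hsum
  have hq0 : 0 < 1 - P 0 := by linarith
  have hQent : Summable fun n => P (n + 1) * Real.logb 2 (P (n + 1)) :=
    (summable_nat_add_iff 1).2 hent
  have hQlog := hanti.summable_mul_logb (fun n => hnonneg (n + 1)) hQ (by linarith) hQent
  have htail := hanti.tsum_mul_logb_le (fun n => hnonneg (n + 1)) hQ hq0 (by linarith) hQent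
  obtain ⟨hGlog, hgeom⟩ := summable_geometric_mul_logb hP0.le hP0'
  have hG := hasSum_geometric_of_lt_one hP0.le hP0'
  obtain ⟨hA, hAle⟩ := summable_mul_length (fun i => pow_nonneg hP0.le i) hG hGlog hL2
  obtain ⟨hB, hBle⟩ := summable_mul_length (fun n => hnonneg (n + 1)) hQ hQlog hL2
  have hhead : P 0 * Real.logb 2 (P 0) + P 1 ≤ 0 := by
    rcases le_total (P 0) (1 / 2) with h | h
    · have hlog : Real.logb 2 (P 0) ≤ -1 := by
        rw [Real.logb_le_iff_le_rpow (by norm_num) hP0]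
        norm_num [Real.rpow_neg_one]
        linarith
      have := mul_le_mul_of_nonneg_left hlog hP0.le
      linarith [hmono 0]
    · have h1 : P 1 ≤ 1 - P 0 := le_hasSum hQ 0 fun n _ => hnonneg (n + 1)
      have hlog := le_logb_two_one_add (t := (1 - P 0) / P 0) (by positivity)
        ((div_le_one hP0).2 (by linarith))
      have heq : 1 + (1 - P 0) / P 0 = (P 0)⁻¹ := by field_simp; ring
      rw [heq, Real.logb_inv, div_le_iff₀ hP0] at hlog
      linarith
  rw [tsum_tsum_mul_add hG hQ hA hB, hent.tsum_eq_zero_add, mul_add, ← mul_assoc (1 - P 0) _⁻¹,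
    mul_inv_cancel₀ hq0.ne', one_mul]
  have hA' := mul_le_mul_of_nonneg_left hAle (mul_nonneg hq0.le hq0.le)
  have hgeom' := mul_le_mul_of_nonneg_left hgeom hq0.le
  have hcancel : (1 - P 0) * (1 - P 0) * ((1 - P 0)⁻¹ * b) = (1 - P 0) * b := by field_simp
  rw [mul_add, hcancel] at hA'
  have hkey := mul_le_mul_of_nonneg_left (add_le_add (add_le_add htail hgeom') hhead)
    (mul_nonneg zero_le_two hb.le)
  simp only [zero_add] at hkey
  linarith
end

section
/- Let P be a decreasing probability distribution on ℕ, let L : ℕ⁺ → ℕ be nondecreasing with L(1) ≥ 1 and L(n) ≤ a + b·⌊log₂ n⌋ for all n ≥ 2, where a, b are positive constants, and suppose the series ∑_{n=1}^∞ P(n)(L(n+1) - L(n)) converges. Suppose there exists t ∈ (0,1) such that L(1)·(t + 1/t - 3) + a·(1-t) + b·(1-t)·(1 + t² + t⁶/(1 - t⁸)) ≤ 0. Then, whenever t ≤ P(0) < 1, one has Δ := (1 - P(0))² · ∑_{i=0}^∞ P(0)^i L(i+1) - P(0)·L(1) - ∑_{n=1}^∞ P(n)·(L(n+1) - L(n))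 < 0; that is, the coding rate R_C of the RLE-based VV code built from L is strictly smaller than the expected codeword length E_P(L) = ∑_{n=0}^∞ P(n) L(n+1) of the code L itself. -/
/-- The tail of the geometric series with its first `k` terms removed. -/
lemma hasSum_geometric_indicator {p : ℝ} (hp0 : 0 ≤ p) (hp1 : p < 1) (k : ℕ) :
    HasSum (fun i : ℕ => p ^ i * (if k ≤ i then (1 : ℝ) else 0)) (p ^ k / (1 - p)) := by
  rw [← hasSum_nat_add_iff' k, Finset.sum_eq_zero, sub_zero]
  · have h := (hasSum_geometric_of_lt_one hp0 hp1).mul_left (p ^ k)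
    rw [← div_eq_mul_inv] at h
    refine h.congr_fun fun i => ?_
    simp [pow_add, mul_comm]
  · intro i hi
    simp [Finset.mem_range.mp hi]

lemma hasSum_geometric_mul_succ_div_eight {p : ℝ} (hp0 : 0 ≤ p) (hp1 : p < 1) :
    HasSum (fun i : ℕ => p ^ i * (((i + 1) / 8 : ℕ) : ℝ))
      (p ^ 7 / ((1 - p) * (1 - p ^ 8))) := by
  have hs : Summable (fun i : ℕ => p ^ i * (((i + 1) / 8 : ℕ) : ℝ)) := by
    have h1 : Summable (fun i : ℕ => (i : ℝ) ^ 1 * p ^ i) :=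
      summable_pow_mul_geometric_of_norm_lt_one 1 (by rwa [Real.norm_of_nonneg hp0])
    refine h1.of_nonneg_of_le (fun i => by positivity) fun i => ?_
    have h2 : (((i + 1) / 8 : ℕ) : ℝ) ≤ (i : ℝ) := by
      exact_mod_cast (by omega : (i + 1) / 8 ≤ i)
    rw [pow_one, mul_comm]
    gcongr
  have hshift : ∑' i : ℕ, p ^ (i + 8) * (((i + 8 + 1) / 8 : ℕ) : ℝ)
      = p ^ 8 * (∑' i : ℕ, p ^ i * (((i + 1) / 8 : ℕ) : ℝ)) + p ^ 8 * (1 - p)⁻¹ := by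
    have h := (hs.hasSum.mul_left (p ^ 8)).add
      ((hasSum_geometric_of_lt_one hp0 hp1).mul_left (p ^ 8))
    rw [← h.tsum_eq]
    refine tsum_congr fun i => ?_
    rw [show (i + 8 + 1) / 8 = (i + 1) / 8 + 1 by omega]
    push_cast
    ring
  have hrec := hs.sum_add_tsum_nat_add 8
  rw [hshift] at hrec
  simp only [Finset.sum_range_succ, Finset.sum_range_zero] at hrec
  norm_num at hrec
  have h8 : p ^ 8 < 1 := pow_lt_one₀ hp0 hp1 (by norm_num)
  have h1p : 1 - p ≠ 0 := by linarith
  have h18 : 1 - p ^ 8 ≠ 0 := by linarith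
  convert hs.hasSum using 1
  rw [div_eq_iff (mul_ne_zero h1p h18)]
  field_simp at hrec
  linear_combination hrec

lemma log_two_le_indicator_add_div_eight (i : ℕ) :
    Nat.log 2 (i + 1) ≤ (if 1 ≤ i then 1 else 0) + (if 3 ≤ i then 1 else 0) + (i + 1) / 8 := by
  rcases lt_or_ge i 7 with h | h
  · interval_cases i <;> decide
  · have h1 : Nat.log 2 (i + 1) = Nat.log 2 ((i + 1) / 2 / 2 / 2) + 3 := by
      rw [Nat.log_div_base, Nat.log_div_base, Nat.log_div_base]
      have : 3 ≤ Nat.log 2 (i + 1) := Nat.le_log_of_pow_le (by norm_num) (by omega)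
      omega
    have h2 : (i + 1) / 2 / 2 / 2 = (i + 1) / 8 := by omega
    have h3 : Nat.log 2 ((i + 1) / 8) < (i + 1) / 8 := Nat.log_lt_self 2 (by omega)
    rw [h1, h2, if_pos (by omega), if_pos (by omega)]
    omega

lemma one_sub_mul_one_add_sq_add_antitone {t x : ℝ} (ht : 0 < t) (htx : t ≤ x) (hx : x < 1) :
    (1 - x) * (1 + x ^ 2 + x ^ 6 / (1 - x ^ 8)) ≤
      (1 - t) * (1 + t ^ 2 + t ^ 6 / (1 - t ^ 8)) := by
  have key : ∀ y : ℝ, 0 < y → y < 1 → (1 - y) * (1 + y ^ 2 + y ^ 6 / (1 - y ^ 8)) =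
      1 - y + y ^ 2 - y ^ 3 + y ^ 6 / ((1 + y) * (1 + y ^ 2) * (1 + y ^ 4)) := by
    intro y hy0 hy1
    have h1 : 1 - y ≠ 0 := by linarith
    have h2 : 1 - y ^ 8 = (1 - y) * ((1 + y) * (1 + y ^ 2) * (1 + y ^ 4)) := by ring
    rw [h2]
    field_simp
    ring
  have hx0 : 0 < x := ht.trans_le htx
  rw [key x hx0 hx, key t ht (htx.trans_lt hx)]
  set D := (1 + x) * (1 + x ^ 2) * (1 + x ^ 4) with hD
  have hDpos : 0 < D := by positivity
  have hDlow : 8 * x ^ 4 ≤ D := by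
    calc 8 * x ^ 4 = (2 * x) * (2 * x) * (2 * x ^ 2) := by ring
      _ ≤ D := by
        rw [hD]
        gcongr
        · linarith
        · nlinarith [sq_nonneg (x - 1)]
        · nlinarith [sq_nonneg (x ^ 2 - 1)]
  have hden : t ^ 6 / D ≤ t ^ 6 / ((1 + t) * (1 + t ^ 2) * (1 + t ^ 4)) := by
    rw [hD]
    gcongr
  have hpow : x ^ 6 - t ^ 6 ≤ (x - t) * (6 * x ^ 5) := by
    have h : x ^ 5 + x ^ 4 * t + x ^ 3 * t ^ 2 + x ^ 2 * t ^ 3 + x * t ^ 4 + t ^ 5 ≤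
        x ^ 5 + x ^ 4 * x + x ^ 3 * x ^ 2 + x ^ 2 * x ^ 3 + x * x ^ 4 + x ^ 5 := by
      gcongr
    have := mul_le_mul_of_nonneg_left h (sub_nonneg.mpr htx)
    linarith
  have hfrac : x ^ 6 / D - t ^ 6 / D ≤ (x - t) * (3 / 4 * x) := by
    rw [← sub_div, div_le_iff₀ hDpos]
    have := mul_le_mul_of_nonneg_left hDlow
      (mul_nonneg (sub_nonneg.mpr htx) (by positivity : 0 ≤ 3 / 4 * x))
    linarith
  have hquad : 0 ≤ 1 - (x + t) + (x ^ 2 + x * t + t ^ 2) - 3 / 4 * x := by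
    nlinarith [sq_nonneg (x + t / 2 - 7 / 8), sq_nonneg (t - 1 / 12)]
  have := mul_nonneg (sub_nonneg.mpr htx) hquad
  linarith

lemma add_one_div_le_of_le {t x : ℝ} (ht : 0 < t) (htx : t ≤ x) (hx : x < 1) :
    x + 1 / x ≤ t + 1 / t := by
  have hx0 : 0 < x := ht.trans_le htx
  have h : t + 1 / t - (x + 1 / x) = (x - t) * (1 - x * t) / (x * t) := by
    field_simp
    ring
  have : 0 ≤ (x - t) * (1 - x * t) / (x * t) :=
    div_nonneg (mul_nonneg (by linarith) (by nlinarith)) (by positivity)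
  linarith

/-- Geometric averages of a sequence with logarithmic growth are strictly below an explicit
closed form. -/
lemma tsum_geometric_mul_lt {p a b : ℝ} (hp0 : 0 < p) (hp1 : p < 1) (hb : 0 < b) {L : ℕ → ℕ}
    (hL : ∀ n : ℕ, 2 ≤ n → (L n : ℝ) ≤ a + b * (Nat.log 2 n : ℝ)) :
    ∑' i : ℕ, p ^ i * (L (i + 1) : ℝ) <
      L 1 + a * (p / (1 - p)) + b * (p / (1 - p) + p ^ 3 / (1 - p)
        + p ^ 7 / ((1 - p) * (1 - p ^ 8))) := by
  set ind : ℕ → ℕ → ℝ := fun k i => if k ≤ i then 1 else 0 with hind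
  set u : ℕ → ℝ := fun i => p ^ i * ((if i = 0 then (L 1 : ℝ) else 0) + a * ind 1 i
    + b * (ind 1 i + ind 3 i + (((i + 1) / 8 : ℕ) : ℝ))) with hu
  have husum : HasSum u (L 1 + a * (p / (1 - p)) + b * (p / (1 - p) + p ^ 3 / (1 - p)
      + p ^ 7 / ((1 - p) * (1 - p ^ 8)))) := by
    have h1 := hasSum_geometric_indicator hp0.le hp1 1
    have h3 := hasSum_geometric_indicator hp0.le hp1 3
    have h8 := hasSum_geometric_mul_succ_div_eight hp0.le hp1
    rw [pow_one] at h1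
    refine (((hasSum_ite_eq 0 (L 1 : ℝ)).add (h1.mul_left a)).add
      (((h1.add h3).add h8).mul_left b)).congr_fun fun i => ?_
    rcases eq_or_ne i 0 with rfl | hi
    · simp [hu, hind]
    · simp only [hu, hind, if_neg hi]
      ring
  have hcast : ∀ i : ℕ, (Nat.log 2 (i + 1) : ℝ) ≤
      ind 1 i + ind 3 i + (((i + 1) / 8 : ℕ) : ℝ) := by
    intro i
    have h := log_two_le_indicator_add_div_eight i
    simp only [hind]
    exact_mod_cast h
  have hle : ∀ i : ℕ, p ^ i * (L (i + 1) : ℝ) ≤ u i := by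
    intro i
    refine mul_le_mul_of_nonneg_left ?_ (by positivity)
    rcases eq_or_ne i 0 with rfl | hi
    · simp [hind]
    · have h := hL (i + 1) (by omega)
      have h' := mul_le_mul_of_nonneg_left (hcast i) hb.le
      have h1 : ind 1 i = 1 := if_pos (by omega)
      simp only [if_neg hi]
      rw [h1] at h' ⊢
      linarith
  have hstrict : p ^ 23 * (L (23 + 1) : ℝ) < u 23 := by
    refine mul_lt_mul_of_pos_left ?_ (by positivity)
    have h := hL 24 (by norm_num)
    have hlog : Nat.log 2 24 = 4 := by
      rw [Nat.log_eq_iff] <;> norm_num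
    rw [hlog] at h
    norm_num [hind] at h ⊢
    linarith
  rw [← husum.tsum_eq]
  exact Summable.tsum_lt_tsum hle hstrict
    (husum.summable.of_nonneg_of_le (fun i => by positivity) hle) husum.summable

/-- Let `P` be a DPD on ℕ and `L` a minimal (nondecreasing) length
function with `L 1 ≥ 1` and `L n ≤ a + b⌊log₂ n⌋` for `n ≥ 2` (`a, b > 0`), such that
`∑_{n≥1} P(n)(L(n+1)-L(n))` converges.  If some `t ∈ (0,1)` satisfies
`L(1)(t + 1/t - 3) + a(1-t) + b(1-t)(1 + t² + t⁶/(1-t⁸)) ≤ 0`, then whenever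
`t ≤ P 0 < 1`,
`Δ = (1-P 0)²·∑_i P(0)^i L(i+1) - P(0)·L(1) - ∑_{n≥1} P(n)(L(n+1)-L(n)) < 0`,
i.e. the coding rate of the RLE-based VV code is strictly smaller than the expected
codeword length of `L`. -/
theorem stmt_18 (P : ℕ → ℝ)
    (hnonneg : ∀ m, 0 ≤ P m)
    (hmono : ∀ m, P (m + 1) ≤ P m)
    (hsum : HasSum P 1)
    (a b : ℝ) (ha : 0 < a) (hb : 0 < b)
    (L : ℕ → ℕ)
    (hLmono : ∀ m : ℕ, 1 ≤ m → L m ≤ L (m + 1))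
    (hL1 : 1 ≤ L 1)
    (hLbound : ∀ n : ℕ, 2 ≤ n → (L n : ℝ) ≤ a + b * (Nat.log 2 n : ℝ))
    (hconv : Summable (fun n : ℕ => P (n + 1) * ((L (n + 2) : ℝ) - (L (n + 1) : ℝ))))
    (t : ℝ) (ht0 : 0 < t) (ht1 : t < 1)
    (htineq : (L 1 : ℝ) * (t + 1 / t - 3) + a * (1 - t)
        + b * (1 - t) * (1 + t ^ 2 + t ^ 6 / (1 - t ^ 8)) ≤ 0)
    (hP0t : t ≤ P 0) (hP0 : P 0 < 1) :
    (1 - P 0) ^ 2 * (∑' i : ℕ, P 0 ^ i * (L (i + 1) : ℝ))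
        - P 0 * (L 1 : ℝ)
        - ∑' n : ℕ, P (n + 1) * ((L (n + 2) : ℝ) - (L (n + 1) : ℝ)) < 0 := by
  have hp0 : 0 < P 0 := ht0.trans_le hP0t
  have htail : 0 ≤ ∑' n : ℕ, P (n + 1) * ((L (n + 2) : ℝ) - (L (n + 1) : ℝ)) :=
    tsum_nonneg fun n => mul_nonneg (hnonneg _)
      (sub_nonneg.mpr (by exact_mod_cast hLmono (n + 1) (by omega)))
  have hseries := tsum_geometric_mul_lt hp0 hP0 hb hLbound
  have hH := mul_le_mul_of_nonneg_left
    (one_sub_mul_one_add_sq_add_antitone ht0 hP0t hP0) hb.le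
  have hG := mul_le_mul_of_nonneg_left (add_one_div_le_of_le ht0 hP0t hP0)
    (Nat.cast_nonneg (α := ℝ) (L 1))
  have hA := mul_le_mul_of_nonneg_left hP0t ha.le
  generalize P 0 = p at *
  have hF : (L 1 : ℝ) * (p + 1 / p - 3) + a * (1 - p)
      + b * (1 - p) * (1 + p ^ 2 + p ^ 6 / (1 - p ^ 8)) ≤ 0 := by
    linarith
  have h1p : 0 < 1 - p := by linarith
  have h8 : 1 - p ^ 8 ≠ 0 := by
    have : p ^ 8 < 1 := pow_lt_one₀ hp0.le hP0 (by norm_num)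
    linarith
  have hclosed : (1 - p) ^ 2 * (L 1 + a * (p / (1 - p)) + b * (p / (1 - p) + p ^ 3 / (1 - p)
        + p ^ 7 / ((1 - p) * (1 - p ^ 8)))) - p * L 1
      = p * ((L 1 : ℝ) * (p + 1 / p - 3) + a * (1 - p)
        + b * (1 - p) * (1 + p ^ 2 + p ^ 6 / (1 - p ^ 8))) := by
    field_simp
    ring
  have hmul := mul_lt_mul_of_pos_left hseries (pow_pos h1p 2)
  have hneg := mul_nonpos_of_nonneg_of_nonpos hp0.le hF
  linarith
end

section
/- Let L : ℕ⁺ → ℕ be nondecreasing with 1 ≤ L(n) ≤ a + b·log₂ n for all n ≥ 1, where a, b are positive constants, and suppose L is asymptotically optimal as a universal code of integers: there exists a function R_L : ℝ → ℝ such that for every decreasing probability distribution P on ℕ with finite entropy, ∑_{n=0}^∞ P(n) L(n+1) ≤ R_L(H(P)) · max{1, H(P)}, and R_L(x) → 1 as x → +∞. Then the RLE-based VV code C built from L is an asymptotically optimal generalized universal code: there exists a function T : ℝ → ℝ such that for every decreasing probability distribution P on ℕ with 0 < H(P) < ∞, the coding rate R_C(P) := (1 - P(0))² · ∑_{i=0}^∞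 P(0)^i L(i+1) + ∑_{n=1}^∞ P(n) L(n) satisfies R_C(P) ≤ T(H(P)) · H(P), and T(x) → 1 as x → +∞. -/
/-- A decreasing probability distribution satisfies `(n + 1) * P n ≤ 1`. -/
lemma succ_mul_le_one_of_antitone {P : ℕ → ℝ} (h0 : ∀ m, 0 ≤ P m)
    (hP : Antitone P) (hs : HasSum P 1) (n : ℕ) : ((n : ℝ) + 1) * P n ≤ 1 := by
  calc ((n : ℝ) + 1) * P n = ∑ _i ∈ Finset.range (n + 1), P n := by simp
    _ ≤ ∑ i ∈ Finset.range (n + 1), P i :=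
        Finset.sum_le_sum fun i hi => hP (by simp at hi; omega)
    _ ≤ 1 := sum_le_hasSum _ (fun i _ => h0 i) hs

/-- For a decreasing probability distribution, `P n * log₂ (n + 1) ≤ -P n * log₂ (P n)`. -/
lemma mul_logb_succ_le_neg_mul_logb {P : ℕ → ℝ} (h0 : ∀ m, 0 ≤ P m)
    (hP : Antitone P) (hs : HasSum P 1) (n : ℕ) :
    P n * Real.logb 2 ((n : ℝ) + 1) ≤ -(P n * Real.logb 2 (P n)) := by
  rcases (h0 n).eq_or_lt with h | h
  · simp [← h]
  · have hn : (0 : ℝ) < (n : ℝ) + 1 := by positivity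
    have hlog : Real.logb 2 (((n : ℝ) + 1) * P n) ≤ 0 :=
      Real.logb_nonpos one_lt_two (by positivity) (succ_mul_le_one_of_antitone h0 hP hs n)
    rw [Real.logb_mul hn.ne' h.ne'] at hlog
    nlinarith

/-- Logarithmically bounded lengths have finite mean under a decreasing probability
distribution of finite entropy. -/
lemma summable_mul_of_le_logb {a b : ℝ} (hb : 0 < b) {f : ℕ → ℝ} (hf0 : ∀ n, 0 ≤ f n)
    (hf : ∀ n : ℕ, f n ≤ a + b * Real.logb 2 ((n : ℝ) + 1)) {P : ℕ → ℝ} (h0 : ∀ m, 0 ≤ P m)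
    (hP : Antitone P) (hs : HasSum P 1)
    (hH : Summable fun n => P n * Real.logb 2 (P n)) :
    Summable fun n => P n * f n := by
  refine Summable.of_nonneg_of_le (fun n => mul_nonneg (h0 n) (hf0 n)) (fun n => ?_)
    ((hs.summable.mul_left a).add (hH.neg.mul_left b))
  have h1 := mul_le_mul_of_nonneg_left (hf n) (h0 n)
  have h2 := mul_le_mul_of_nonneg_left (mul_logb_succ_le_neg_mul_logb h0 hP hs n) hb.le
  linarith

/-- The mean of a logarithmically bounded length under the geometric distribution, scaled by
`1 - p`, is at most `a + b`. -/
lemma sq_mul_tsum_pow_mul_le {a b : ℝ} (ha : 0 < a) (hb : 0 < b) {f : ℕ → ℝ}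
    (hf0 : ∀ n, 0 ≤ f n) (hf : ∀ n : ℕ, f n ≤ a + b * Real.logb 2 ((n : ℝ) + 1))
    {p : ℝ} (hp0 : 0 ≤ p) (hp1 : p ≤ 1) :
    (1 - p) ^ 2 * ∑' i : ℕ, p ^ i * f i ≤ a + b := by
  rcases hp1.eq_or_lt with rfl | hp
  · norm_num
    positivity
  have hnorm : ‖p‖ < 1 := by rwa [Real.norm_of_nonneg hp0]
  have hgeom := hasSum_geometric_of_lt_one hp0 hp
  have hsum := (hgeom.mul_left a).add ((hasSum_coe_mul_geometric_of_norm_lt_one hnorm).mul_left b)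
  have hle : ∀ i : ℕ, p ^ i * f i ≤ a * p ^ i + b * ((i : ℝ) * p ^ i) := fun i => by
    have hlog : Real.logb 2 ((i : ℝ) + 1) ≤ i := by
      rw [Real.logb_le_iff_le_rpow one_lt_two (by positivity), Real.rpow_natCast]
      exact_mod_cast Nat.lt_two_pow_self
    have h1 : f i ≤ a + b * i := (hf i).trans (by gcongr)
    have h2 := mul_le_mul_of_nonneg_left h1 (pow_nonneg hp0 i)
    linarith
  have hsf : Summable fun i : ℕ => p ^ i * f i :=
    Summable.of_nonneg_of_le (fun i => mul_nonneg (pow_nonneg hp0 i) (hf0 i)) hle hsum.summable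
  have hq : 0 < 1 - p := by linarith
  calc (1 - p) ^ 2 * ∑' i : ℕ, p ^ i * f i
      ≤ (1 - p) ^ 2 * (a * (1 - p)⁻¹ + b * (p / (1 - p) ^ 2)) := by
        gcongr
        exact hasSum_le hle hsf.hasSum hsum
    _ = a * (1 - p) + b * p := by field_simp
    _ ≤ a + b := by nlinarith

/-- Let `L` be a minimal (nondecreasing) length function with
`1 ≤ L n ≤ a + b·log₂ n` for all `n ≥ 1` (`a, b > 0`) which is asymptotically optimal
as a UCI: there is `R_L : ℝ → ℝ` with `∑_n P(n) L(n+1) ≤ R_L(H(P))·max{1, H(P)}` for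
every DPD `P` with finite entropy, and `R_L(x) → 1` as `x → ∞`.  Then the RLE-based VV
code built from `L` is an asymptotically optimal GUCI: there is `T : ℝ → ℝ` with
`R_C(P) = (1-P 0)²·∑_i P(0)^i L(i+1) + ∑_{n≥1} P(n) L(n) ≤ T(H(P))·H(P)` for every DPD
`P` with `0 < H(P) < ∞`, and `T(x) → 1` as `x → ∞`. -/
theorem stmt_19 (a b : ℝ) (ha : 0 < a) (hb : 0 < b)
    (L : ℕ → ℕ)
    (hLmono : ∀ m : ℕ, 1 ≤ m → L m ≤ L (m + 1))
    (hL1 : ∀ n : ℕ, 1 ≤ n → 1 ≤ L n)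
    (hLbound : ∀ n : ℕ, 1 ≤ n → (L n : ℝ) ≤ a + b * Real.logb 2 n)
    (R : ℝ → ℝ)
    (hR : ∀ P : ℕ → ℝ, (∀ m, 0 ≤ P m) → (∀ m, P (m + 1) ≤ P m) → HasSum P 1 →
        Summable (fun n => P n * Real.logb 2 (P n)) →
        (∑' n : ℕ, P n * (L (n + 1) : ℝ))
          ≤ R (-∑' n : ℕ, P n * Real.logb 2 (P n))
              * max 1 (-∑' n : ℕ, P n * Real.logb 2 (P n)))
    (hRlim : Filter.Tendsto R Filter.atTop (nhds 1)) :
    ∃ T : ℝ → ℝ,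
      (∀ P : ℕ → ℝ, (∀ m, 0 ≤ P m) → (∀ m, P (m + 1) ≤ P m) → HasSum P 1 →
        Summable (fun n => P n * Real.logb 2 (P n)) →
        0 < -∑' n : ℕ, P n * Real.logb 2 (P n) →
        (1 - P 0) ^ 2 * (∑' i : ℕ, P 0 ^ i * (L (i + 1) : ℝ))
            + ∑' n : ℕ, P (n + 1) * (L (n + 1) : ℝ)
          ≤ T (-∑' n : ℕ, P n * Real.logb 2 (P n))
              * (-∑' n : ℕ, P n * Real.logb 2 (P n))) ∧
      Filter.Tendsto T Filter.atTop (nhds 1) := by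
  have hf0 : ∀ n : ℕ, (0 : ℝ) ≤ L (n + 1) := fun n => by positivity
  have hf : ∀ n : ℕ, (L (n + 1) : ℝ) ≤ a + b * Real.logb 2 ((n : ℝ) + 1) := fun n => by
    simpa using hLbound (n + 1) (by omega)
  refine ⟨fun x => (a + b) / x + R x * (max 1 x / x), fun P h0 hdec hs hH hpos => ?_, ?_⟩
  · have hP : Antitone P := antitone_nat_of_succ_le hdec
    have hsum := summable_mul_of_le_logb hb hf0 hf h0 hP hs hH
    have hp1 : P 0 ≤ 1 := by simpa using succ_mul_le_one_of_antitone h0 hP hs 0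
    have hrun := sq_mul_tsum_pow_mul_le ha hb hf0 hf (h0 0) hp1
    have hle : ∀ n, P (n + 1) * (L (n + 1) : ℝ) ≤ P n * (L (n + 1) : ℝ) := fun n =>
      mul_le_mul_of_nonneg_right (hdec n) (hf0 n)
    have hshift := (Summable.of_nonneg_of_le (fun n => mul_nonneg (h0 _) (hf0 n)) hle
      hsum).tsum_le_tsum hle hsum
    have hRP := hR P h0 hdec hs hH
    set H := -∑' n : ℕ, P n * Real.logb 2 (P n)
    have hT : ((a + b) / H + R H * (max 1 H / H)) * H = (a + b) + R H * max 1 H := by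
      field_simp
    linarith
  · have h1 : Filter.Tendsto (fun x : ℝ => (a + b) / x) Filter.atTop (nhds 0) :=
      tendsto_const_nhds.div_atTop Filter.tendsto_id
    have h2 : Filter.Tendsto (fun x : ℝ => max 1 x / x) Filter.atTop (nhds 1) := by
      refine tendsto_const_nhds.congr' ?_
      filter_upwards [Filter.eventually_ge_atTop 1] with x hx
      rw [max_eq_right hx, div_self (by linarith)]
    simpa using h1.add (hRlim.mul h2)
end
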